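/- arXiv:2203.04630 — 2 statements merged into one kernel-verified Lean document; each statement's English description precedes it below -/
import Mathlib

section
/- Let 𝔖 be a split system on a finite multiset 𝓜. Then 𝔖 is compatible if and only if the split-containment graph Γ(𝔖) has a consistent thin subgraph. -/
open scoped Classical

/-- A split of a multiset `M`: an unordered pair of nonempty submultisets of `M`
whose multiset union is `M`. -/
def IsSplit {X : Type} (M : Multiset X) (S : Sym2 (Multiset X)) : Prop :=
  ∃ A B : Multiset X, S = s(A, B) ∧ A ≠ 0 ∧ B ≠ 0 ∧ A + B = M

/-- A split system on `M`: a multiset of splits of `M`. -/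
def IsSplitSystem {X : Type} (M : Multiset X) (𝔖 : Multiset (Sym2 (Multiset X))) : Prop :=
  ∀ S ∈ 𝔖, IsSplit M S

/-- An `M`-tree: a finite tree whose vertices are labelled by submultisets of `M`
such that (M1) the multiset union of all labels is `M`, and (M2) every vertex of
degree 1 or 2 has a nonempty label. -/
structure MTree (X : Type) (M : Multiset X) where
  n : ℕ
  G : SimpleGraph (Fin n)
  connected : G.Connected
  acyclic : G.IsAcyclic
  label : Fin n → Multiset X
  m1 : ∑ v, label v = M
  m2 : ∀ v, G.degree v = 1 ∨ G.degree v = 2 → label v ≠ 0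

namespace MTree

variable {X : Type} {M : Multiset X}

/-- The part of the split induced by the edge `{u, v}` lying on the side of `u`:
the multiset union of the labels of the vertices in the connected component of `u`
after deleting the edge `{u, v}`. -/
noncomputable def part (T : MTree X M) (u v : Fin T.n) : Multiset X :=
  ∑ w ∈ Finset.univ.filter (fun w => (T.G.deleteEdges {s(u, v)}).Reachable u w), T.label w

/-- The multiset of splits represented by an `M`-tree: the splits induced by its edges. -/
noncomputable def splits (T : MTree X M) : Multiset (Sym2 (Multiset X)) :=
  T.G.edgeFinset.val.map
    (Sym2.lift ⟨fun u v => s(T.part u v, T.part v u), fun u v => Sym2.eq_swap⟩)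

end MTree

/-- A split system on `M` is compatible if some `M`-tree represents it. -/
def Compatible {X : Type} (M : Multiset X) (𝔖 : Multiset (Sym2 (Multiset X))) : Prop :=
  ∃ T : MTree X M, T.splits = 𝔖

/-- `Δ(M) = Σ_{x ∈ X} (M(x) - 1)`. -/
def delta {X : Type} [DecidableEq X] (M : Multiset X) : ℕ :=
  ∑ x ∈ M.toFinset, (M.count x - 1)

/-- The split system `{S₁, …, Sₙ}` determined by an indexed family of ordered splits,
where split `i` has parts `P i true` and `P i false`. -/
def splitSystemOf {X : Type} {n : ℕ} (P : Fin n → Bool → Multiset X) :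
    Multiset (Sym2 (Multiset X)) :=
  (Finset.univ.val : Multiset (Fin n)).map fun i => s(P i true, P i false)

/-- The arcs of the split-containment graph `Γ(𝔖)`: its vertices are the pairs
`(i, b)` (representing the pair `(P i b, Sᵢ)` of a part of the split `Sᵢ` together
with `Sᵢ`), and there is an arc from `(i, b)` to `(j, c)` iff `i ≠ j` and
`P i b ⊊ P j c` as multisets. -/
def GammaArc {X : Type} {n : ℕ} (P : Fin n → Bool → Multiset X)
    (u v : Fin n × Bool) : Prop :=
  u.1 ≠ v.1 ∧ P u.1 u.2 < P v.1 v.2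

/-- A thin subgraph of `Γ(𝔖)`: a spanning subgraph `G` of `Γ(𝔖)` such that for all
distinct `i, j` the restriction of `G` to the four vertices coming from `Sᵢ` and `Sⱼ`
has exactly two arcs, of the form `((C,Sᵢ),(D,Sⱼ))` and `((D̄,Sⱼ),(C̄,Sᵢ))`. -/
def IsThinSubgraph {X : Type} {n : ℕ} (P : Fin n → Bool → Multiset X)
    (G : Fin n × Bool → Fin n × Bool → Prop) : Prop :=
  (∀ u v, G u v → GammaArc P u v) ∧
  ∀ i j : Fin n, i ≠ j → ∃ b c : Bool, ∀ b' c' : Bool,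
    (G (i, b') (j, c') ↔ b' = b ∧ c' = c) ∧
    (G (j, c') (i, b') ↔ c' = !c ∧ b' = !b)

/-- An arc `(u, v)` of a digraph `G` is critical if the only directed path in `G`
from `u` to `v` is the arc itself. -/
def IsCriticalArc {V : Type} (G : V → V → Prop) (u v : V) : Prop :=
  G u v ∧ ¬ ∃ w, G u w ∧ w ≠ v ∧ Relation.TransGen G w v

/-- A (thin) subgraph `G` of `Γ(𝔖)` is consistent if for every vertex `(A, Sᵢ)` of `G`,
the multiset union of the parts `B` over all vertices `(B, Sⱼ)` such that
`((B,Sⱼ),(A,Sᵢ))` is a critical arc of `G` is a submultiset of `A`. -/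
def IsConsistent {X : Type} {n : ℕ} (P : Fin n → Bool → Multiset X)
    (G : Fin n × Bool → Fin n × Bool → Prop) : Prop :=
  ∀ u : Fin n × Bool,
    (∑ w ∈ Finset.univ.filter (fun w => IsCriticalArc G w u), P w.1 w.2) ≤ P u.1 u.2

/-- A part `A` of a split `A|Ā ∈ 𝔖` is a terminal set of `𝔖` if for every split
`B|B̄` of `𝔖` other than (this occurrence of) `A|Ā`, neither `B ⊊ A` nor `B̄ ⊊ A`. -/
def IsTerminal {X : Type} [DecidableEq X] (M : Multiset X)
    (𝔖 : Multiset (Sym2 (Multiset X))) (A : Multiset X) : Prop :=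
  s(A, M - A) ∈ 𝔖 ∧ ∀ T ∈ 𝔖.erase s(A, M - A), ∀ B ∈ T, ¬ B < A

/-- A terminal set `A` of `𝔖` is a superterminal set if in addition, for every split
`B|B̄` of `𝔖` other than `A|Ā`, exactly one of `A ⊊ B`, `A ⊊ B̄` holds. -/
def IsSuperterminal {X : Type} [DecidableEq X] (M : Multiset X)
    (𝔖 : Multiset (Sym2 (Multiset X))) (A : Multiset X) : Prop :=
  IsTerminal M 𝔖 A ∧
    ∀ T ∈ 𝔖.erase s(A, M - A), ∀ B C : Multiset X, T = s(B, C) → (A < B ↔ ¬ A < C)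

/-- Two splits are compatible if they have parts `A ∈ S₁`, `B ∈ S₂` with `A ∩ B = ∅`
(multiset intersection). -/
def SplitPairCompatible {X : Type} [DecidableEq X] (S₁ S₂ : Sym2 (Multiset X)) : Prop :=
  ∃ A ∈ S₁, ∃ B ∈ S₂, A ∩ B = 0

/-- A split system is pairwise compatible if any two of its splits are compatible. -/
def PairwiseCompatible {X : Type} [DecidableEq X] (𝔖 : Multiset (Sym2 (Multiset X))) : Prop :=
  ∀ S₁ ∈ 𝔖, ∀ S₂ ∈ 𝔖.erase S₁, SplitPairCompatible S₁ S₂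

/-- The size of a split `A|B` is `min {|A|, |B|}`. -/
def splitSize {X : Type} : Sym2 (Multiset X) → ℕ :=
  Sym2.lift ⟨fun A B => min A.card B.card, fun A B => min_comm _ _⟩

/-- Isomorphism of `M`-trees: a graph isomorphism preserving the labels. -/
def MTreeIso {X : Type} {M : Multiset X} (T T' : MTree X M) : Prop :=
  ∃ φ : Fin T.n ≃ Fin T'.n,
    (∀ u v, T.G.Adj u v ↔ T'.G.Adj (φ u) (φ v)) ∧ ∀ v, T'.label (φ v) = T.label v

/-- Isomorphism of digraphs. -/
def DigraphIso {V W : Type} (R : V → V → Prop) (Q : W → W → Prop) : Prop :=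
  ∃ φ : V ≃ W, ∀ a b, R a b ↔ Q (φ a) (φ b)

/-- The digraph `D₁` on the four vertices `v = 0`, `w = 1`, `p = 2`, `q = 3`,
with arcs `(v,p)` and `(q,w)`. -/
def D1 : Fin 4 → Fin 4 → Prop := fun a b => (a = 0 ∧ b = 2) ∨ (a = 3 ∧ b = 1)

/-- The digraph `D₂` on the four vertices `v = 0`, `w = 1`, `p = 2`, `q = 3`,
with arcs `(v,p)`, `(p,w)`, `(v,q)` and `(q,w)`. -/
def D2 : Fin 4 → Fin 4 → Prop :=
  fun a b => (a = 0 ∧ b = 2) ∨ (a = 2 ∧ b = 1) ∨ (a = 0 ∧ b = 3) ∨ (a = 3 ∧ b = 1)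

/-- Isomorphism of subgraphs of `Γ(𝔖)`: a digraph isomorphism mapping each vertex
`(A, Sᵢ)` to a vertex `(B, Sⱼ)` with `A = B`. -/
def SubgraphIso {X : Type} {n : ℕ} (P : Fin n → Bool → Multiset X)
    (G G' : Fin n × Bool → Fin n × Bool → Prop) : Prop :=
  ∃ φ : Fin n × Bool ≃ Fin n × Bool,
    (∀ u v, G u v ↔ G' (φ u) (φ v)) ∧ ∀ u, P (φ u).1 (φ u).2 = P u.1 u.2

theorem Multiset.exists_list_map_eq {α β : Type*} (f : α → β) (L : List β) :
    ∀ s : Multiset α, s.map f = ↑L → ∃ l : List α, (↑l : Multiset α) = s ∧ l.map f = L := by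
  induction L with
  | nil =>
    intro s hs
    exact ⟨[], by simpa [eq_comm] using hs, rfl⟩
  | cons b L ih =>
    intro s hs
    rw [← Multiset.cons_coe] at hs
    obtain ⟨a, ha, rfl, ht⟩ := (Multiset.map_eq_cons f s _ b).2 hs
    obtain ⟨l, hl, rfl⟩ := ih _ ht
    exact ⟨a :: l, by rw [← Multiset.cons_coe, hl, Multiset.cons_erase ha], rfl⟩

theorem Multiset.exists_enumeration {α β : Type*} {n : ℕ} (f : α → β) (g : Fin n → β)
    (s : Multiset α) (hs : s.Nodup) (h : s.map f = (Finset.univ.val : Multiset (Fin n)).map g) :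
    ∃ e : Fin n → α, Function.Injective e ∧ (∀ a, a ∈ s ↔ ∃ i, e i = a) ∧ ∀ i, f (e i) = g i := by
  have h' : s.map f = ↑(List.ofFn g) := by
    rw [h, List.ofFn_eq_map]; rfl
  obtain ⟨l, rfl, hl⟩ := Multiset.exists_list_map_eq f _ s h'
  obtain rfl : l.length = n := by simpa using congrArg List.length hl
  refine ⟨fun i => l.get i, List.nodup_iff_injective_get.1 (by simpa using hs), fun a => ?_,
    fun i => ?_⟩
  · simp [List.mem_iff_get]
  · have := congrArg (fun l => l[i.1]?) hl
    simpa using this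

namespace SimpleGraph

variable {V : Type*} {G : SimpleGraph V} {u v x y w : V}

/-- The vertices that can be reached from `u` without using the edge `{u, v}`. -/
def side (G : SimpleGraph V) (u v : V) : Set V :=
  {w | (G.deleteEdges {s(u, v)}).Reachable u w}

theorem self_mem_side : u ∈ G.side u v := Reachable.refl _

theorem mem_side_of_adj (h : s(u, v) ≠ s(x, y)) (hxy : G.Adj x y) (hx : x ∈ G.side u v) :
    y ∈ G.side u v :=
  Reachable.trans hx (Adj.reachable (by simpa [deleteEdges_adj, hxy] using h.symm))

theorem mem_side_iff_of_adj (h : s(u, v) ≠ s(x, y)) (hxy : G.Adj x y) :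
    x ∈ G.side u v ↔ y ∈ G.side u v :=
  ⟨mem_side_of_adj h hxy, mem_side_of_adj (by rwa [Sym2.eq_swap (a := y)]) hxy.symm⟩

theorem side_subset_of_closed {s : Set V} (hu : u ∈ s)
    (hs : ∀ x y, G.Adj x y → s(u, v) ≠ s(x, y) → x ∈ G.side u v → x ∈ s → y ∈ s) :
    G.side u v ⊆ s := by
  intro w hw
  have hw' := (reachable_iff_reflTransGen _ _).1 hw
  clear hw
  induction hw' with
  | refl => exact hu
  | tail h1 h2 ih =>
    rw [deleteEdges_adj] at h2
    exact hs _ _ h2.1 (fun h => h2.2 h.symm) ((reachable_iff_reflTransGen _ _).2 h1) ih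

theorem side_subset_side (h : s(u, v) ≠ s(x, y)) (hx : x ∉ G.side u v) (hu : u ∈ G.side x y)
    (hxy : G.Adj x y) : G.side u v ⊆ G.side x y := by
  have hy : y ∉ G.side u v := fun hy => hx ((mem_side_iff_of_adj h hxy).2 hy)
  refine side_subset_of_closed hu fun a b hab _ ha ha' => mem_side_of_adj ?_ hab ha'
  intro heq
  rcases Sym2.eq_iff.1 heq with ⟨rfl, rfl⟩ | ⟨rfl, rfl⟩
  exacts [hx ha, hy ha]

theorem Connected.mem_side_or (hG : G.Connected) (u v w : V) :
    w ∈ G.side u v ∨ w ∈ G.side v u := by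
  have h := (reachable_iff_reflTransGen _ _).1 (hG.preconnected u w)
  induction h with
  | refl => exact Or.inl self_mem_side
  | @tail b c _ h2 ih =>
    by_cases heq : s(u, v) = s(b, c)
    · rcases Sym2.eq_iff.1 heq with ⟨rfl, rfl⟩ | ⟨rfl, rfl⟩
      exacts [Or.inr self_mem_side, Or.inl self_mem_side]
    · exact ih.imp (mem_side_of_adj heq h2)
        (mem_side_of_adj (by rwa [Sym2.eq_swap (a := v)]) h2)

theorem IsAcyclic.side_disjoint (hG : G.IsAcyclic) (huv : G.Adj u v) (h : w ∈ G.side u v)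
    (h' : w ∈ G.side v u) : False := by
  have hb := isBridge_iff.1 (isAcyclic_iff_forall_adj_isBridge.1 hG huv)
  have h'' : (G.deleteEdges {s(u, v)}).Reachable v w := by
    rw [Sym2.eq_swap]; exact h'
  exact hb (Reachable.trans h h''.symm)

theorem IsTree.mem_side_swap (hG : G.IsTree) (huv : G.Adj u v) :
    w ∈ G.side v u ↔ w ∉ G.side u v :=
  ⟨fun h h' => hG.2.side_disjoint huv h' h, fun h => (hG.1.mem_side_or u v w).resolve_left h⟩

/-- Between two nested sides of a tree there is a vertex of degree at most two, or
a whole further side. -/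
theorem IsTree.exists_between [Fintype V] [DecidableRel G.Adj] (hG : G.IsTree)
    (huv : G.Adj u v) (hxy : G.Adj x y)
    (hne : s(u, v) ≠ s(x, y)) (hsub : G.side u v ⊆ G.side x y) :
    v ∈ G.side x y ∧ v ∉ G.side u v ∧ (G.degree v = 1 ∨ G.degree v = 2 ∨
      ∃ p, G.Adj p v ∧ G.side p v ⊆ G.side x y ∧ ∀ w ∈ G.side p v, w ∉ G.side u v) := by
  have hv : v ∈ G.side x y := mem_side_of_adj hne.symm huv (hsub self_mem_side)
  have hv' : v ∉ G.side u v := (hG.mem_side_swap huv).1 self_mem_side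
  have hy : y ∉ G.side x y := (hG.mem_side_swap hxy).1 self_mem_side
  refine ⟨hv, hv', ?_⟩
  have key : ∀ p, G.Adj p v → p ≠ u → y ∉ G.side p v →
      G.side p v ⊆ G.side x y ∧ ∀ w ∈ G.side p v, w ∉ G.side u v := by
    intro p hp hpu hyp
    have h1 : s(p, v) ≠ s(x, y) := by
      intro h
      rcases Sym2.eq_iff.1 h with ⟨rfl, rfl⟩ | ⟨rfl, rfl⟩
      · exact hy hv
      · exact hyp self_mem_side
    have h2 : s(p, v) ≠ s(v, u) := by
      intro h
      rcases Sym2.eq_iff.1 h with ⟨rfl, rfl⟩ | ⟨rfl, -⟩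
      · exact hpu rfl
      · exact hpu rfl
    have h3 : v ∉ G.side p v := (hG.mem_side_swap hp).1 self_mem_side
    constructor
    · refine side_subset_side h1 (fun hx => hyp (mem_side_of_adj h1 hxy hx)) ?_ hxy
      exact mem_side_of_adj (by rw [Sym2.eq_swap (a := v)]; exact h1.symm) hp.symm hv
    · intro w hw
      refine (hG.mem_side_swap huv).1 (side_subset_side h2 h3 ?_ huv.symm hw)
      exact mem_side_of_adj (by rw [Sym2.eq_swap (a := v) (b := p)]; exact h2.symm) hp.symm
        self_mem_side
  by_contra! hcon
  obtain ⟨hd1, hd2, hno⟩ := hcon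
  have hbad : ∀ p, G.Adj p v → p ≠ u → y ∈ G.side p v := by
    intro p hp hpu
    by_contra hyp
    obtain ⟨ha, hb⟩ := key p hp hpu hyp
    obtain ⟨w, hw, hw'⟩ := hno p hp ha
    exact hb w hw hw'
  have huniq : ∀ p q, G.Adj p v → p ≠ u → G.Adj q v → q ≠ u → p = q := by
    intro p q hp hpu hq hqu
    by_contra hpq
    have h1 : s(p, v) ≠ s(v, q) := by
      intro h
      rcases Sym2.eq_iff.1 h with ⟨rfl, rfl⟩ | ⟨rfl, -⟩ <;> exact hpq rfl
    have h3 : v ∉ G.side p v := (hG.mem_side_swap hp).1 self_mem_side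
    have h2 : s(v, q) ≠ s(v, p) := by
      rw [Sym2.eq_swap (a := v) (b := p)]
      exact h1.symm
    have h4 : p ∈ G.side v q := mem_side_of_adj h2 hp.symm self_mem_side
    exact hG.2.side_disjoint hq (hbad q hq hqu)
      (side_subset_side h1 h3 h4 hq.symm (hbad p hp hpu))
  have hsubset : ∃ p, G.neighborFinset v ⊆ {u, p} := by
    by_cases h : ∃ p, G.Adj p v ∧ p ≠ u
    · obtain ⟨p, hp, hpu⟩ := h
      refine ⟨p, fun q hq => ?_⟩
      have hq' : G.Adj q v := ((G.mem_neighborFinset v q).1 hq).symm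
      by_cases hqu : q = u
      · simp [hqu]
      · simp [huniq q p hq' hqu hp hpu]
    · push Not at h
      refine ⟨u, fun q hq => ?_⟩
      have hq' : G.Adj q v := ((G.mem_neighborFinset v q).1 hq).symm
      simp [h q hq']
  obtain ⟨p, hp⟩ := hsubset
  have hle := (Finset.card_le_card hp).trans Finset.card_le_two
  have hpos : 0 < (G.neighborFinset v).card :=
    Finset.card_pos.2 ⟨u, by simpa using huv.symm⟩
  rw [G.card_neighborFinset_eq_degree] at hle hpos
  omega

end SimpleGraph

section TreeToThin

variable {X V : Type} {n : ℕ} {G : SimpleGraph V}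

/-- The side of the oriented edge `x i b`, `x i !b`. -/
def dartSide (G : SimpleGraph V) (x : Fin n → Bool → V) (u : Fin n × Bool) : Set V :=
  G.side (x u.1 u.2) (x u.1 !u.2)

theorem mem_dartSide_not (hG : G.IsTree) {x : Fin n → Bool → V}
    (hadj : ∀ i b, G.Adj (x i b) (x i !b)) (i : Fin n) (b : Bool) (w : V) :
    w ∈ dartSide G x (i, !b) ↔ w ∉ dartSide G x (i, b) := by
  have := hG.mem_side_swap (w := w) (hadj i b)
  simpa [dartSide] using this

theorem mem_dartSide_base {x : Fin n → Bool → V}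
    (hadj : ∀ i b, G.Adj (x i b) (x i !b))
    (hinj : ∀ i j b c, i ≠ j → s(x i b, x i !b) ≠ s(x j c, x j !c))
    {i j : Fin n} (hij : i ≠ j) {b c d : Bool} (h : x j c ∈ dartSide G x (i, b)) :
    x j d ∈ dartSide G x (i, b) := by
  have h1 := SimpleGraph.mem_side_of_adj (hinj i j b c hij) (hadj j c) h
  cases c <;> cases d <;> first | exact h | exact h1

theorem dartSide_trichotomy (hG : G.IsTree) {x : Fin n → Bool → V}
    (hadj : ∀ i b, G.Adj (x i b) (x i !b))
    (hinj : ∀ i j b c, i ≠ j → s(x i b, x i !b) ≠ s(x j c, x j !c))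
    {i j : Fin n} (hij : i ≠ j) : ∃ b c, dartSide G x (i, b) ⊆ dartSide G x (j, c) := by
  have h1 : ∃ b, x j true ∉ dartSide G x (i, b) := by
    by_cases h : x j true ∈ dartSide G x (i, true)
    · exact ⟨false, fun h' => (mem_dartSide_not hG hadj i true _).1 h' h⟩
    · exact ⟨true, h⟩
  have h2 : ∃ c, x i true ∈ dartSide G x (j, c) := by
    by_cases h : x i true ∈ dartSide G x (j, true)
    · exact ⟨true, h⟩
    · exact ⟨false, (mem_dartSide_not hG hadj j true _).2 h⟩
  obtain ⟨b, hb⟩ := h1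
  obtain ⟨c, hc⟩ := h2
  exact ⟨b, c, SimpleGraph.side_subset_side (hinj i j b c hij)
    (fun h => hb (mem_dartSide_base hadj hinj hij h)) (mem_dartSide_base hadj hinj hij.symm hc)
    (hadj j c)⟩

theorem dartSide_compl (hG : G.IsTree) {x : Fin n → Bool → V}
    (hadj : ∀ i b, G.Adj (x i b) (x i !b)) (i : Fin n) (b : Bool) :
    dartSide G x (i, !b) = (dartSide G x (i, b))ᶜ :=
  Set.ext fun w => mem_dartSide_not hG hadj i b w

theorem dartSide_thin (hG : G.IsTree) {x : Fin n → Bool → V}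
    (hadj : ∀ i b, G.Adj (x i b) (x i !b))
    (hinj : ∀ i j b c, i ≠ j → s(x i b, x i !b) ≠ s(x j c, x j !c))
    {i j : Fin n} (hij : i ≠ j) : ∃ b c, ∀ b' c',
      (dartSide G x (i, b') ⊆ dartSide G x (j, c') ↔ b' = b ∧ c' = c) ∧
      (dartSide G x (j, c') ⊆ dartSide G x (i, b') ↔ c' = !c ∧ b' = !b) := by
  obtain ⟨b, c, hbc⟩ := dartSide_trichotomy hG hadj hinj hij
  have hself : ∀ i b, x i b ∈ dartSide G x (i, b) := fun i b => SimpleGraph.self_mem_side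
  have hnot : ∀ i b, x i (!b) ∉ dartSide G x (i, b) := fun i b =>
    (mem_dartSide_not hG hadj i b _).1 (hself i !b)
  have hcompl := dartSide_compl hG hadj
  have hdet : ∀ b' c', dartSide G x (i, b') ⊆ dartSide G x (j, c') → b' = b ∧ c' = c := by
    intro b' c' h
    have hc : c' = c := by
      by_contra hne
      obtain rfl : c' = !c := Bool.eq_not.2 hne
      have h1 := hbc (hself i b)
      have h2 := mem_dartSide_base (d := b) hadj hinj hij.symm (h (hself i b'))
      exact (mem_dartSide_not hG hadj j c _).1 h2 h1
    subst hc
    refine ⟨?_, rfl⟩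
    by_contra hne
    obtain rfl : b' = !b := Bool.eq_not.2 hne
    apply hnot j c'
    by_cases hm : x j (!c') ∈ dartSide G x (i, b)
    · exact hbc hm
    · exact h ((mem_dartSide_not hG hadj i b _).2 hm)
  have hiff : ∀ b' c', dartSide G x (i, b') ⊆ dartSide G x (j, c') ↔ b' = b ∧ c' = c := by
    refine fun b' c' => ⟨hdet b' c', ?_⟩
    rintro ⟨rfl, rfl⟩
    exact hbc
  refine ⟨b, c, fun b' c' => ⟨hiff b' c', ?_⟩⟩
  have h := hiff (!b') (!c')
  rw [hcompl, hcompl, Set.compl_subset_compl] at h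
  rw [h]
  cases b <;> cases c <;> cases b' <;> cases c' <;> simp

theorem exists_consistent_thin_of_tree [Fintype V] (hG : G.IsTree) {x : Fin n → Bool → V}
    (hadj : ∀ i b, G.Adj (x i b) (x i !b))
    (hinj : ∀ i j b c, i ≠ j → s(x i b, x i !b) ≠ s(x j c, x j !c))
    (hsurj : ∀ p q, G.Adj p q → ∃ i b, p = x i b ∧ q = x i !b)
    (label : V → Multiset X) (hlabel : ∀ v, G.degree v = 1 ∨ G.degree v = 2 → label v ≠ 0)
    (P : Fin n → Bool → Multiset X) (hne : ∀ i b, P i b ≠ 0)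
    (hP : ∀ i b, P i b = ∑ w ∈ Finset.univ.filter (fun w => w ∈ dartSide G x (i, b)), label w) :
    ∃ H, IsThinSubgraph P H ∧ IsConsistent P H := by
  have hself : ∀ i b, x i b ∈ dartSide G x (i, b) := fun i b => SimpleGraph.self_mem_side
  refine ⟨fun u v => u.1 ≠ v.1 ∧ dartSide G x u ⊆ dartSide G x v, ⟨?_, ?_⟩, ?_⟩
  · rintro ⟨i, b⟩ ⟨j, c⟩ ⟨hij, hsub⟩
    refine ⟨hij, ?_⟩
    have hsub' : Finset.univ.filter (fun w => w ∈ dartSide G x (i, b)) ⊆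
        Finset.univ.filter (fun w => w ∈ dartSide G x (j, c)) := fun w hw => by
      simpa using hsub (by simpa using hw)
    have hle : P i b ≤ P j c := by
      rw [hP, hP]; exact Finset.sum_le_sum_of_subset hsub'
    refine lt_of_le_of_ne hle fun heq => ?_
    have hzero : ∀ w ∈ dartSide G x (j, c), w ∉ dartSide G x (i, b) → label w = 0 := by
      have h := Finset.sum_sdiff hsub' (f := label)
      rw [← hP, ← hP, heq] at h
      have h0 := (Finset.sum_eq_zero_iff.1 (add_eq_right.1 h))
      exact fun w h1 h2 => h0 w (by simp [h1, h2])
    obtain ⟨h1, h2, h3⟩ := hG.exists_between (hadj i b) (hadj j c) (hinj i j b c hij) hsub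
    have hl := hzero _ h1 h2
    rcases h3 with h3 | h3 | ⟨p, hp, hpj, hpi⟩
    · exact hlabel _ (Or.inl h3) hl
    · exact hlabel _ (Or.inr h3) hl
    · obtain ⟨k, d, rfl, hk⟩ := hsurj _ _ hp
      have hside : G.side (x k d) (x i !b) = dartSide G x (k, d) := by rw [hk]; rfl
      rw [hside] at hpj hpi
      apply hne k d
      rw [hP]
      refine Finset.sum_eq_zero fun w hw => ?_
      have hw' := (Finset.mem_filter.1 hw).2
      exact hzero w (hpj hw') (hpi w hw')
  · intro i j hij
    obtain ⟨b, c, h⟩ := dartSide_thin hG hadj hinj hij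
    exact ⟨b, c, fun b' c' => by simpa [hij, hij.symm] using h b' c'⟩
  · rintro ⟨j, c⟩
    simp only [hP]
    have hcompl := dartSide_compl hG hadj
    have hdisj : ∀ u v : Fin n × Bool, u ≠ v → u.1 ≠ j → v.1 ≠ j →
        dartSide G x u ⊆ dartSide G x (j, c) → dartSide G x v ⊆ dartSide G x (j, c) →
        (u.1 ≠ v.1 → ¬ dartSide G x u ⊆ dartSide G x v) →
        (u.1 ≠ v.1 → ¬ dartSide G x v ⊆ dartSide G x u) →
        Disjoint (dartSide G x u) (dartSide G x v) := by
      rintro ⟨i, b⟩ ⟨k, d⟩ huv hij hkj hi hk hn1 hn2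
      by_cases hik : i = k
      · subst hik
        obtain rfl : d = !b := Bool.eq_not.2 fun h => huv (by rw [h])
        rw [hcompl]
        exact disjoint_compl_right
      · obtain ⟨b', d', h⟩ := dartSide_trichotomy hG hadj hinj hik
        specialize hn1 hik
        specialize hn2 hik
        by_cases hb : b' = b
        · subst hb
          have hd : d' = !d := by
            cases d <;> cases d' <;> first | rfl | exact absurd h hn1
          subst hd
          rw [hcompl] at h
          exact Set.subset_compl_iff_disjoint_right.1 h
        · obtain rfl : b' = !b := Bool.eq_not.2 hb
          exfalso
          by_cases hd : d' = d
          · subst hd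
            have hnot := (mem_dartSide_not hG hadj j c (x j !c)).1 (hself j !c)
            apply hnot
            by_cases hm : x j (!c) ∈ dartSide G x (i, b)
            · exact hi hm
            · exact hk (h ((mem_dartSide_not hG hadj i b _).2 hm))
          · obtain rfl : d' = !d := Bool.eq_not.2 hd
            rw [hcompl, hcompl, Set.compl_subset_compl] at h
            exact hn2 h
    rw [← Finset.sum_biUnion]
    · refine Finset.sum_le_sum_of_subset ?_
      intro w hw
      simp only [Finset.mem_biUnion, Finset.mem_filter, Finset.mem_univ, true_and] at hw ⊢
      obtain ⟨u, hu, hw⟩ := hw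
      exact hu.1.2 hw
    · intro u hu v hv huv
      simp only [Finset.coe_filter, Finset.mem_univ, true_and, Set.mem_ofPred_eq] at hu hv
      have hneq : ∀ u v : Fin n × Bool, u ≠ v → u.1 ≠ v.1 →
          IsCriticalArc (fun u v : Fin n × Bool =>
            u.1 ≠ v.1 ∧ dartSide G x u ⊆ dartSide G x v) u (j, c) → v.1 ≠ j →
          dartSide G x v ⊆ dartSide G x (j, c) → ¬ dartSide G x u ⊆ dartSide G x v := by
        intro u v _ h1 hu hv hv' hsub
        refine hu.2 ⟨v, ⟨h1, hsub⟩, ?_, Relation.TransGen.single ⟨hv, hv'⟩⟩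
        rintro rfl
        exact hv rfl
      have hd := hdisj u v huv hu.1.1 hv.1.1 hu.1.2 hv.1.2
        (fun h => hneq u v huv h hu hv.1.1 hv.1.2)
        (fun h => hneq v u huv.symm h.symm hv hu.1.1 hu.1.2)
      refine Finset.disjoint_left.2 fun w hw hw' => ?_
      exact Set.disjoint_left.1 hd (Finset.mem_filter.1 hw).2 (Finset.mem_filter.1 hw').2

end TreeToThin

theorem exists_consistent_thin_of_compatible {X : Type} {M : Multiset X} {n : ℕ}
    {P : Fin n → Bool → Multiset X} (hne : ∀ i b, P i b ≠ 0)
    (h : Compatible M (splitSystemOf P)) :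
    ∃ H, IsThinSubgraph P H ∧ IsConsistent P H := by
  obtain ⟨T, hT⟩ := h
  obtain ⟨e, he, hmem, hf⟩ := Multiset.exists_enumeration _ _ _ T.G.edgeFinset.nodup hT
  have hx : ∀ i, ∃ x : Bool → Fin T.n, e i = s(x true, x false) ∧
      P i true = T.part (x true) (x false) ∧ P i false = T.part (x false) (x true) := by
    intro i
    have hi := hf i
    revert hi
    induction e i with
    | h u v =>
      intro hi
      rcases Sym2.eq_iff.1 (show s(T.part u v, T.part v u) = s(P i true, P i false) from hi) with
        ⟨h1, h2⟩ | ⟨h1, h2⟩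
      · exact ⟨fun b => cond b u v, rfl, h1.symm, h2.symm⟩
      · exact ⟨fun b => cond b v u, Sym2.eq_swap, h2.symm, h1.symm⟩
  choose x hx1 hx2 hx3 using hx
  have hxe : ∀ i b, s(x i b, x i !b) = e i := by
    rintro i (_ | _)
    · rw [hx1, Sym2.eq_swap]; rfl
    · exact (hx1 i).symm
  refine exists_consistent_thin_of_tree (G := T.G) (x := x) ⟨T.connected, T.acyclic⟩ ?_ ?_ ?_
    T.label T.m2 P hne ?_
  · intro i b
    have := (hmem (e i)).2 ⟨i, rfl⟩
    rw [← hxe i b] at this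
    simpa using this
  · intro i j b c hij
    rw [hxe, hxe]
    exact he.ne hij
  · intro p q hpq
    obtain ⟨i, hi⟩ := (hmem s(p, q)).1 (by simpa using hpq)
    rw [hx1] at hi
    rcases Sym2.eq_iff.1 hi with ⟨rfl, rfl⟩ | ⟨rfl, rfl⟩
    exacts [⟨i, true, rfl, rfl⟩, ⟨i, false, rfl, rfl⟩]
  · rintro i (_ | _)
    · rw [hx3, MTree.part]
      exact Finset.sum_congr (by ext; simp [dartSide, SimpleGraph.side]) fun _ _ => rfl
    · rw [hx2, MTree.part]
      exact Finset.sum_congr (by ext; simp [dartSide, SimpleGraph.side]) fun _ _ => rfl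

section ParentGraph

variable {n : ℕ} {p : Fin n → Fin (n + 1)}

/-- The graph on `Fin (n + 1)` in which each `i.succ` is joined to its parent `p i`. -/
def parentGraph (p : Fin n → Fin (n + 1)) : SimpleGraph (Fin (n + 1)) :=
  SimpleGraph.fromEdgeSet (Set.range fun i => s(i.succ, p i))

variable {μ : Fin (n + 1) → ℕ}

theorem parentGraph_adj (hμ : ∀ i, μ (p i) < μ i.succ)
    {u v : Fin (n + 1)} :
    (parentGraph p).Adj u v ↔ ∃ i : Fin n, s(i.succ, p i) = s(u, v) := by
  simp only [parentGraph, SimpleGraph.fromEdgeSet_adj, Set.mem_range, and_iff_left_iff_imp]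
  rintro ⟨i, hi⟩ rfl
  have h := hμ i
  rcases Sym2.eq_iff.1 hi with ⟨h1, h2⟩ | ⟨h1, h2⟩ <;> simp [h1, h2] at h

theorem parentGraph_adj_parent (hμ : ∀ i, μ (p i) < μ i.succ)
    (i : Fin n) : (parentGraph p).Adj i.succ (p i) :=
  (parentGraph_adj hμ).2 ⟨i, rfl⟩

theorem parent_edge_injective (hμ : ∀ i, μ (p i) < μ i.succ) :
    Function.Injective fun i : Fin n => s(i.succ, p i) := by
  intro i j hij
  rcases Sym2.eq_iff.1 hij with ⟨h1, -⟩ | ⟨h1, h2⟩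
  · exact Fin.succ_injective _ h1
  · have h3 := hμ i
    have h4 := hμ j
    rw [h2] at h3
    rw [← h1] at h4
    omega

theorem parentGraph_connected (hμ : ∀ i, μ (p i) < μ i.succ) :
    (parentGraph p).Connected := by
  have h : ∀ k v, μ v = k → (parentGraph p).Reachable v 0 := by
    intro k
    induction k using Nat.strong_induction_on with
    | h k ih =>
      intro v hv
      cases v using Fin.cases with
      | zero => rfl
      | succ i =>
        exact (parentGraph_adj_parent hμ i).reachable.trans (ih _ (hv ▸ hμ i) _ rfl)
  exact ⟨fun u v => (h _ u rfl).trans (h _ v rfl).symm⟩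

theorem parentGraph_side (hμ : ∀ i, μ (p i) < μ i.succ)
    {i : Fin n} {D : Set (Fin (n + 1))} (hi : i.succ ∈ D) (hp : p i ∉ D)
    (hD : ∀ j, j ≠ i → (p j ∈ D ↔ j.succ ∈ D)) :
    (parentGraph p).side i.succ (p i) = D ∧ (parentGraph p).side (p i) i.succ = Dᶜ := by
  have hiff : ∀ u v, (parentGraph p).Adj u v → s(i.succ, p i) ≠ s(u, v) → (u ∈ D ↔ v ∈ D) := by
    intro u v huv hne
    obtain ⟨j, hj⟩ := (parentGraph_adj hμ).1 huv
    have hji : j ≠ i := by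
      rintro rfl
      exact hne hj
    rcases Sym2.eq_iff.1 hj with ⟨rfl, rfl⟩ | ⟨rfl, rfl⟩
    exacts [(hD j hji).symm, hD j hji]
  have h1 : (parentGraph p).side i.succ (p i) ⊆ D :=
    SimpleGraph.side_subset_of_closed hi fun u v huv hne _ => (hiff u v huv hne).1
  have h2 : (parentGraph p).side (p i) i.succ ⊆ Dᶜ :=
    SimpleGraph.side_subset_of_closed hp fun u v huv hne _ hu hv =>
      hu ((hiff u v huv (by rwa [Sym2.eq_swap (a := i.succ)])).2 hv)
  have h3 := (parentGraph_connected hμ).mem_side_or i.succ (p i)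
  exact ⟨h1.antisymm fun w hw => (h3 w).resolve_right fun h => h2 h hw,
    h2.antisymm fun w hw => (h3 w).resolve_left fun h => hw (h1 h)⟩

theorem parentGraph_acyclic (hμ : ∀ i, μ (p i) < μ i.succ)
    (D : Fin n → Set (Fin (n + 1))) (hi : ∀ i : Fin n, i.succ ∈ D i)
    (hp : ∀ i, p i ∉ D i) (hD : ∀ i j, j ≠ i → (p j ∈ D i ↔ j.succ ∈ D i)) :
    (parentGraph p).IsAcyclic := by
  rw [SimpleGraph.isAcyclic_iff_forall_isBridge]
  intro e he
  induction e with
  | h u v =>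
    obtain ⟨i, hi'⟩ := (parentGraph_adj hμ).1 he
    rw [← hi', SimpleGraph.isBridge_iff]
    intro hr
    have h : p i ∈ (parentGraph p).side i.succ (p i) := hr
    rw [(parentGraph_side hμ (hi i) (hp i) (hD i)).1] at h
    exact hp i h

end ParentGraph

section Forest

variable {X : Type} {n : ℕ}

/-- `j` covers `c` in the forest order `lt`. -/
def ForestCovers (lt : Fin n → Fin n → Prop) (c j : Fin n) : Prop :=
  lt c j ∧ ∀ k, lt c k → k = j ∨ lt j k

theorem exists_forestCovers {Q : Fin n → Multiset X} {lt : Fin n → Fin n → Prop}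
    (hlt : ∀ i j, lt i j → Q i < Q j)
    (hchain : ∀ i j k, lt i j → lt i k → j = k ∨ lt j k ∨ lt k j) {i k : Fin n} (hik : lt i k) :
    ∃ j, ForestCovers lt i j := by
  obtain ⟨j, hj, hmin⟩ := Finset.exists_min_image (Finset.univ.filter fun k => lt i k)
    (fun k => (Q k).card) ⟨k, by simpa using hik⟩
  have hj' : lt i j := (Finset.mem_filter.1 hj).2
  refine ⟨j, hj', fun k hk => ?_⟩
  rcases hchain i j k hj' hk with h | h | h
  · exact Or.inl h.symm
  · exact Or.inr h
  · exact absurd (Multiset.card_lt_card (hlt _ _ h)) (hmin k (by simpa using hk)).not_gt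

theorem compatible_of_forest {M : Multiset X} {Q R : Fin n → Multiset X}
    (hQR : ∀ i, Q i + R i = M) (hQ : ∀ i, Q i ≠ 0) (top : Fin n) (hR : R top ≠ 0)
    {lt : Fin n → Fin n → Prop} (htrans : ∀ i j k, lt i j → lt j k → lt i k)
    (hlt : ∀ i j, lt i j → Q i < Q j)
    (hchain : ∀ i j k, lt i j → lt i k → j = k ∨ lt j k ∨ lt k j)
    (htop : ∀ j, j ≠ top → lt j top)
    (hcons : ∀ j, ∑ c ∈ Finset.univ.filter (fun c => ForestCovers lt c j), Q c ≤ Q j) :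
    Compatible M ((Finset.univ.val : Multiset (Fin n)).map fun i => s(Q i, R i)) := by
  have hirr : ∀ i, ¬ lt i i := fun i h => (hlt i i h).false
  have hp : ∀ i, ∃ v : Fin (n + 1), (i = top → v = 0) ∧
      ∀ j : Fin n, v = j.succ ↔ ForestCovers lt i j := by
    intro i
    by_cases h : i = top
    · refine ⟨0, fun _ => rfl, fun j => ⟨fun h' => absurd h'.symm (Fin.succ_ne_zero j), ?_⟩⟩
      rintro ⟨h1, -⟩
      subst h
      by_cases hj : j = i
      · exact absurd (hj ▸ h1) (hirr i)
      · exact absurd (htrans _ _ _ h1 (htop j hj)) (hirr i)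
    · obtain ⟨j, hj⟩ := exists_forestCovers hlt hchain (htop i h)
      refine ⟨j.succ, fun h' => absurd h' h, fun k => ⟨fun h' => ?_, fun h' => ?_⟩⟩
      · rwa [← Fin.succ_injective _ h']
      · rcases hj.2 k h'.1 with h1 | h1
        · rw [h1]
        · rcases h'.2 j hj.1 with h2 | h2
          · rw [h2]
          · exact absurd (htrans _ _ _ h1 h2) (hirr j)
  choose p hp0 hps using hp
  obtain ⟨μ, hμ⟩ : ∃ μ : Fin (n + 1) → ℕ, ∀ i, μ (p i) < μ i.succ := by
    refine ⟨Fin.cons 0 fun j => 1 + (M.card - (Q j).card), fun i => ?_⟩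
    have hv : ∀ v, p i = v → (Fin.cons 0 fun j => 1 + (M.card - (Q j).card) :
        Fin (n + 1) → ℕ) v < (Fin.cons 0 fun j => 1 + (M.card - (Q j).card) :
        Fin (n + 1) → ℕ) i.succ := by
      intro v
      cases v using Fin.cases with
      | zero => simp
      | succ j =>
        intro h
        have h1 := Multiset.card_lt_card (hlt _ _ ((hps i j).1 h).1)
        have h2 := congrArg Multiset.card (hQR j)
        rw [Multiset.card_add] at h2
        simp only [Fin.cons_succ]
        omega
    exact hv _ rfl
  have hlabel : ∀ j, ∃ L, L + ∑ c ∈ Finset.univ.filter (fun c => p c = j.succ), Q c = Q j := by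
    intro j
    obtain ⟨L, hL⟩ := exists_add_of_le (hcons j)
    refine ⟨L, ?_⟩
    rw [hL, add_comm]
    simp only [hps]
  choose L hL using hlabel
  let DD : Fin n → Finset (Fin n) := fun i => Finset.univ.filter fun j => j = i ∨ lt j i
  have hDD : ∀ i j, j ∈ DD i ↔ j = i ∨ lt j i := fun i j => by simp [DD]
  have hpD : ∀ i c j, p c = Fin.succ j → (j ∈ DD i ↔ c ∈ DD i ∧ c ≠ i) := by
    intro i c j hcj
    have hc := (hps c j).1 hcj
    rw [hDD, hDD]
    constructor
    · rintro (rfl | h)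
      · exact ⟨Or.inr hc.1, fun h => hirr c (h ▸ hc.1)⟩
      · have h1 := htrans _ _ _ hc.1 h
        exact ⟨Or.inr h1, fun h => hirr c (h ▸ h1)⟩
    · rintro ⟨h | h, hne⟩
      · exact absurd h hne
      · exact (hc.2 i h).imp Eq.symm id
  have hpex : ∀ i c, c ∈ DD i → c ≠ i → ∃ j, p c = Fin.succ j := by
    intro i c hc hne
    have h := ((hDD i c).1 hc).resolve_left hne
    obtain ⟨j, hj⟩ := exists_forestCovers hlt hchain h
    exact ⟨j, (hps c j).2 hj⟩
  let D : Fin n → Set (Fin (n + 1)) := fun i => {v | ∃ j ∈ DD i, v = Fin.succ j}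
  have hDsucc : ∀ i j, Fin.succ j ∈ D i ↔ j ∈ DD i := by
    intro i j
    constructor
    · rintro ⟨k, hk, h⟩
      rwa [Fin.succ_injective _ h]
    · exact fun h => ⟨j, h, rfl⟩
  have hD1 : ∀ i, Fin.succ i ∈ D i := fun i => (hDsucc i i).2 ((hDD i i).2 (Or.inl rfl))
  have hD2 : ∀ i, p i ∉ D i := by
    rintro i ⟨j, hj, h⟩
    exact ((hpD i i j h).1 hj).2 rfl
  have hD3 : ∀ i j, j ≠ i → (p j ∈ D i ↔ j.succ ∈ D i) := by
    intro i j hji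
    rw [hDsucc]
    constructor
    · rintro ⟨k, hk, h⟩
      exact ((hpD i j k h).1 hk).1
    · intro h
      obtain ⟨k, hk⟩ := hpex i j h hji
      exact ⟨k, (hpD i j k hk).2 ⟨h, hji⟩, hk⟩
  have hsumDD : ∀ i, ∑ j ∈ DD i, L j = Q i := by
    intro i
    have h1 : ∑ j ∈ DD i, (L j + ∑ c ∈ Finset.univ.filter (fun c => p c = j.succ), Q c) =
        ∑ j ∈ DD i, Q j := Finset.sum_congr rfl fun j _ => hL j
    have hbi : (DD i).biUnion (fun j => Finset.univ.filter (fun c => p c = j.succ)) =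
        (DD i).erase i := by
      ext c
      simp only [Finset.mem_biUnion, Finset.mem_filter, Finset.mem_univ, true_and,
        Finset.mem_erase]
      constructor
      · rintro ⟨j, hj, h⟩
        exact ((hpD i c j h).1 hj).symm
      · rintro ⟨h1, h2⟩
        obtain ⟨j, hj⟩ := hpex i c h2 h1
        exact ⟨j, (hpD i c j hj).2 ⟨h2, h1⟩, hj⟩
    rw [Finset.sum_add_distrib, ← Finset.sum_biUnion, hbi,
      ← Finset.sum_erase_add (DD i) Q ((hDD i i).2 (Or.inl rfl)), add_comm] at h1
    · exact add_left_cancel h1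
    · intro j _ k _ hjk
      refine Finset.disjoint_left.2 fun c hc hc' => hjk ?_
      simp only [Finset.mem_filter, Finset.mem_univ, true_and] at hc hc'
      exact Fin.succ_injective _ (hc.symm.trans hc')
  let label : Fin (n + 1) → Multiset X := Fin.cons (R top) L
  have hm1 : ∑ v, label v = M := by
    have hu : DD top = Finset.univ := by
      ext j
      simp only [hDD, Finset.mem_univ, iff_true]
      by_cases h : j = top
      exacts [Or.inl h, Or.inr (htop j h)]
    rw [Fin.sum_univ_succ]
    simp only [label, Fin.cons_zero, Fin.cons_succ]
    rw [← hu, hsumDD, add_comm, hQR]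
  have hm2 : ∀ v, (parentGraph p).degree v = 1 ∨ (parentGraph p).degree v = 2 → label v ≠ 0 := by
    intro v
    cases v using Fin.cases with
    | zero => exact fun _ => hR
    | succ j =>
      intro hdeg h0
      have hj := hL j
      rw [show L j = 0 from h0, zero_add] at hj
      obtain ⟨c, hc⟩ : (Finset.univ.filter (fun c => p c = j.succ)).Nonempty := by
        rw [Finset.nonempty_iff_ne_empty]
        intro h
        rw [h, Finset.sum_empty] at hj
        exact hQ j hj.symm
      obtain ⟨d, hd, hdc⟩ : ∃ d ∈ Finset.univ.filter (fun c => p c = j.succ), d ≠ c := by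
        by_contra! hcon
        rw [Finset.eq_singleton_iff_unique_mem.2 ⟨hc, hcon⟩, Finset.sum_singleton] at hj
        exact (hlt c j ((hps c j).1 (Finset.mem_filter.1 hc).2).1).ne hj
      have hc := (Finset.mem_filter.1 hc).2
      have hd := (Finset.mem_filter.1 hd).2
      have hsub : ({p j, c.succ, d.succ} : Finset (Fin (n + 1))) ⊆
          (parentGraph p).neighborFinset j.succ := by
        intro v hv
        simp only [Finset.mem_insert, Finset.mem_singleton] at hv
        rw [SimpleGraph.mem_neighborFinset]
        rcases hv with rfl | rfl | rfl
        · exact parentGraph_adj_parent hμ j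
        · exact hc ▸ (parentGraph_adj_parent hμ c).symm
        · exact hd ▸ (parentGraph_adj_parent hμ d).symm
      have hne : ∀ c : Fin n, p c = j.succ → p j ≠ c.succ := by
        intro c hc h
        have h1 := hμ c
        have h2 := hμ j
        rw [hc] at h1
        rw [h] at h2
        omega
      have hcard := Finset.card_le_card hsub
      rw [SimpleGraph.card_neighborFinset_eq_degree, Finset.card_eq_three.2
        ⟨_, _, _, hne c hc, hne d hd, fun h => hdc (Fin.succ_injective _ h).symm, rfl⟩] at hcard
      omega
  let T : MTree X M :=
    { n := n + 1
      G := parentGraph p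
      connected := parentGraph_connected hμ
      acyclic := parentGraph_acyclic hμ D hD1 hD2 hD3
      label := label
      m1 := hm1
      m2 := hm2 }
  have hside := fun i => parentGraph_side hμ (hD1 i) (hD2 i) (hD3 i)
  have hpart1 : ∀ i : Fin n, T.part i.succ (p i) = Q i := by
    intro i
    have h : Finset.univ.filter (fun w => (T.G.deleteEdges {s(i.succ, p i)}).Reachable i.succ w) =
        (DD i).map (Fin.succEmb n) := by
      ext w
      have hw : w ∈ (parentGraph p).side i.succ (p i) ↔ w ∈ D i := by rw [(hside i).1]
      rw [Finset.mem_filter, and_iff_right (Finset.mem_univ _), Finset.mem_map]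
      refine hw.trans ?_
      exact exists_congr fun j => and_congr_right fun _ => eq_comm
    rw [MTree.part, h, Finset.sum_map, ← hsumDD i]
    rfl
  have hpart2 : ∀ i : Fin n, T.part (p i) i.succ = R i := by
    intro i
    have h : T.part i.succ (p i) + T.part (p i) i.succ = M := by
      refine Eq.trans ?_ hm1
      rw [MTree.part, MTree.part]
      have h2 : Finset.univ.filter
          (fun w => (T.G.deleteEdges {s(p i, i.succ)}).Reachable (p i) w) = Finset.univ.filter
          (fun w => ¬ (T.G.deleteEdges {s(i.succ, p i)}).Reachable i.succ w) := by
        refine Finset.filter_congr fun w _ => ?_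
        have hw1 : w ∈ (parentGraph p).side i.succ (p i) ↔ w ∈ D i := by rw [(hside i).1]
        have hw2 : w ∈ (parentGraph p).side (p i) i.succ ↔ w ∉ D i := by
          rw [(hside i).2]; rfl
        exact hw2.trans (not_congr hw1.symm)
      rw [h2]
      exact Finset.sum_filter_add_sum_filter_not _ _ _
    rw [hpart1] at h
    exact add_left_cancel (h.trans (hQR i).symm)
  refine ⟨T, ?_⟩
  have hedge : T.G.edgeFinset = Finset.univ.map
      ⟨fun i : Fin n => s(i.succ, p i), parent_edge_injective hμ⟩ := by
    ext e
    induction e with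
    | h u v =>
      rw [SimpleGraph.mem_edgeFinset]
      refine (parentGraph_adj hμ).trans ?_
      simp
  rw [MTree.splits, hedge, Finset.map_val, Multiset.map_map]
  refine Multiset.map_congr rfl fun i _ => ?_
  change s(T.part i.succ (p i), T.part (p i) i.succ) = _
  rw [hpart1, hpart2]

end Forest

section Thin

variable {X : Type} {n : ℕ}

/-- The vertex given by the complementary part of the same split. -/
def complVertex (u : Fin n × Bool) : Fin n × Bool := (u.1, !u.2)

@[simp]
theorem complVertex_complVertex (u : Fin n × Bool) : complVertex (complVertex u) = u := by
  simp [complVertex]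

@[simp]
theorem complVertex_fst (u : Fin n × Bool) : (complVertex u).1 = u.1 := rfl

theorem complVertex_ne (u : Fin n × Bool) : complVertex u ≠ u := by
  intro h
  simpa [complVertex] using congrArg Prod.snd h

theorem eq_or_eq_complVertex {u v : Fin n × Bool} (h : u.1 = v.1) :
    u = v ∨ u = complVertex v := by
  obtain ⟨i, b⟩ := u
  obtain ⟨j, c⟩ := v
  obtain rfl : i = j := h
  cases b <;> cases c <;> simp [complVertex]

variable {P : Fin n → Bool → Multiset X} {G : Fin n × Bool → Fin n × Bool → Prop}

namespace IsThinSubgraph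

variable {u v w : Fin n × Bool}

theorem fst_ne (hG : IsThinSubgraph P G) (h : G u v) : u.1 ≠ v.1 := (hG.1 u v h).1

theorem part_lt (hG : IsThinSubgraph P G) (h : G u v) : P u.1 u.2 < P v.1 v.2 := (hG.1 u v h).2

theorem compl (hG : IsThinSubgraph P G) (h : G u v) : G (complVertex v) (complVertex u) := by
  obtain ⟨b, c, hbc⟩ := hG.2 u.1 v.1 (hG.fst_ne h)
  obtain ⟨h1, h2⟩ := (hbc u.2 v.2).1.1 h
  exact (hbc (!u.2) (!v.2)).2.2 ⟨by rw [h2], by rw [h1]⟩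

theorem not_compl_right (hG : IsThinSubgraph P G) (h : G u v) : ¬ G u (complVertex v) := by
  intro h'
  obtain ⟨b, c, hbc⟩ := hG.2 u.1 v.1 (hG.fst_ne h)
  have h1 := ((hbc u.2 v.2).1.1 h).2
  have h2 := ((hbc u.2 (!v.2)).1.1 h').2
  exact absurd (h2.trans h1.symm) (by simp)

theorem not_compl_left (hG : IsThinSubgraph P G) (h : G u v) : ¬ G (complVertex u) v := by
  intro h'
  have := hG.compl h'
  rw [complVertex_complVertex] at this
  exact hG.not_compl_right (hG.compl h) (by simpa using this)

theorem total (hG : IsThinSubgraph P G) (h : u.1 ≠ v.1) :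
    G u v ∨ G u (complVertex v) ∨ G (complVertex u) v ∨ G v u := by
  obtain ⟨b, c, hbc⟩ := hG.2 u.1 v.1 h
  by_cases hb : u.2 = b <;> by_cases hc : v.2 = c
  · exact Or.inl ((hbc u.2 v.2).1.2 ⟨hb, hc⟩)
  · exact Or.inr (Or.inl ((hbc u.2 (!v.2)).1.2 ⟨hb, (Bool.not_eq.2 hc)⟩))
  · exact Or.inr (Or.inr (Or.inl ((hbc (!u.2) v.2).1.2 ⟨Bool.not_eq.2 hb, hc⟩)))
  · exact Or.inr (Or.inr (Or.inr ((hbc u.2 v.2).2.2 ⟨Bool.eq_not.2 hc, Bool.eq_not.2 hb⟩)))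

theorem part_le_of_path (hG : IsThinSubgraph P G) (h : Relation.ReflTransGen G u v) :
    P u.1 u.2 ≤ P v.1 v.2 := by
  induction h with
  | refl => exact le_rfl
  | tail _ h ih => exact ih.trans (hG.part_lt h).le

theorem path_compl (hG : IsThinSubgraph P G) (h : Relation.ReflTransGen G u v) :
    Relation.ReflTransGen G (complVertex v) (complVertex u) := by
  induction h with
  | refl => exact .refl
  | tail _ h ih => exact .head (hG.compl h) ih

theorem exists_critical (hG : IsThinSubgraph P G) (h : Relation.TransGen G w v) :
    ∃ w', Relation.ReflTransGen G w w' ∧ IsCriticalArc G w' v := by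
  obtain ⟨z, hz, hzv⟩ := Relation.TransGen.tail'_iff.1 h
  obtain ⟨w', hw', hmax⟩ := Finset.exists_max_image
    (Finset.univ.filter fun w' => Relation.ReflTransGen G w w' ∧ G w' v)
    (fun w' => (P w'.1 w'.2).card) ⟨z, by simp [hz, hzv]⟩
  obtain ⟨h1, h2⟩ := (Finset.mem_filter.1 hw').2
  refine ⟨w', h1, h2, ?_⟩
  rintro ⟨y, hy, -, hyv⟩
  obtain ⟨x, hx, hxv⟩ := Relation.TransGen.tail'_iff.1 hyv
  have h3 := hmax x (by simp [(h1.tail hy).trans hx, hxv])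
  have h4 := Multiset.card_lt_card ((hG.part_lt hy).trans_le (hG.part_le_of_path hx))
  omega

theorem no_crossing_paths (hG : IsThinSubgraph P G) {M : Multiset X} (hne : ∀ i b, P i b ≠ 0)
    (hsum : ∀ i b, P i b + P i (!b) = M) (hcons : IsConsistent P G) :
    ∀ (k : ℕ) (v w₁ w₂ : Fin n × Bool), (P v.1 v.2).card = k → Relation.TransGen G w₁ v →
      Relation.TransGen G w₂ v → ¬ Relation.ReflTransGen G (complVertex w₂) w₁ := by
  intro k
  induction k using Nat.strong_induction_on with
  | h k ih =>
    rintro v w₁ w₂ rfl h₁ h₂ hr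
    obtain ⟨y₁, hy₁, hc₁⟩ := hG.exists_critical h₁
    obtain ⟨y₂, hy₂, hc₂⟩ := hG.exists_critical h₂
    by_cases hy : y₁ = y₂
    · subst hy
      have hlt := Multiset.card_lt_card (hG.part_lt hc₁.1)
      have hloop : ¬ Relation.ReflTransGen G (complVertex y₁) y₁ := by
        intro hloop
        rcases Relation.ReflTransGen.cases_head hloop with heq | ⟨x, hx, hxy⟩
        · exact complVertex_ne _ heq
        rcases Relation.ReflTransGen.cases_tail hxy with heq | ⟨z, hz, hzy⟩
        · exact hG.fst_ne hx (by rw [heq]; rfl)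
        · refine ih _ hlt y₁ z (complVertex x) rfl (.single hzy) (.single ?_) ?_
          · simpa using hG.compl hx
          · simpa using hz
      rcases Relation.reflTransGen_iff_eq_or_transGen.1 hy₁ with h1 | h1
      · subst h1
        exact hloop ((hG.path_compl hy₂).trans hr)
      rcases Relation.reflTransGen_iff_eq_or_transGen.1 hy₂ with h2 | h2
      · subst h2
        exact hloop (hr.trans hy₁)
      exact ih _ hlt y₁ w₁ w₂ rfl h1 h2 hr
    · have hle : P y₁.1 y₁.2 + P y₂.1 y₂.2 ≤ P v.1 v.2 := by
        refine le_trans ?_ (hcons v)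
        rw [← Finset.sum_pair (f := fun w : Fin n × Bool => P w.1 w.2) hy]
        refine Finset.sum_le_sum_of_subset fun w hw => ?_
        rcases Finset.mem_insert.1 hw with rfl | hw
        · simp [hc₁]
        · simp [Finset.mem_singleton.1 hw, hc₂]
      have h1 := Multiset.card_le_card hle
      have h2 := Multiset.card_le_card (hG.part_le_of_path hy₁)
      have h3 := Multiset.card_le_card (hG.part_le_of_path hy₂)
      have h4 := Multiset.card_le_card (hG.part_le_of_path hr)
      have h5 := congrArg Multiset.card (hsum w₂.1 w₂.2)
      have h6 := congrArg Multiset.card (hsum v.1 v.2)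
      have h7 := Multiset.card_pos.2 (hne v.1 !v.2)
      simp only [Multiset.card_add, complVertex] at *
      omega

theorem trans (hG : IsThinSubgraph P G) {M : Multiset X} (hne : ∀ i b, P i b ≠ 0)
    (hsum : ∀ i b, P i b + P i (!b) = M) (hcons : IsConsistent P G)
    (huv : G u v) (hvw : G v w) : G u w := by
  have key := hG.no_crossing_paths hne hsum hcons
  have hlt := (hG.part_lt huv).trans (hG.part_lt hvw)
  have huw : u.1 ≠ w.1 := by
    intro h
    rcases eq_or_eq_complVertex h with rfl | rfl
    · exact hlt.false
    · exact hG.not_compl_left hvw (by simpa using hG.compl huv)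
  rcases hG.total huw with h | h | h | h
  · exact h
  · refine absurd (.single ?_) (key _ (complVertex u) w (complVertex v) rfl (.single ?_)
      (.single (hG.compl huv)))
    · simpa using hG.compl h
    · simpa using hvw
  · refine absurd (.single ?_) (key _ w v (complVertex u) rfl (.single hvw) (.single h))
    simpa using huv
  · exact absurd (hlt.trans (hG.part_lt h)) (lt_irrefl _)

end IsThinSubgraph

theorem compatible_zero (M : Multiset X) : Compatible M 0 := by
  refine ⟨{ n := 1, G := ⊥, connected := ?_, acyclic := ?_, label := fun _ => M,
            m1 := ?_, m2 := ?_ }, ?_⟩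
  · exact ⟨fun u v => by rw [Subsingleton.elim u v]⟩
  · exact SimpleGraph.isAcyclic_bot
  · simp
  · intro v h
    simp at h
  · simp [MTree.splits]

theorem compatible_of_consistent_thin {M : Multiset X} (hne : ∀ i b, P i b ≠ 0)
    (hsum : ∀ i b, P i b + P i (!b) = M) (hG : IsThinSubgraph P G) (hcons : IsConsistent P G) :
    Compatible M (splitSystemOf P) := by
  rcases isEmpty_or_nonempty (Fin n) with hn | hn
  · have h : splitSystemOf P = 0 := by simp [splitSystemOf]
    rw [h]
    exact compatible_zero M
  have htrans : ∀ {u v w}, G u v → G v w → G u w := fun h h' => hG.trans hne hsum hcons h h'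
  obtain ⟨r, hr⟩ := Finite.exists_min fun u : Fin n × Bool => (P u.1 u.2).card
  have hmin : ∀ u, ¬ G u r := fun u h =>
    (Multiset.card_lt_card (hG.part_lt h)).not_ge (hr u)
  have ha : ∀ j, ∃ b, (j, b) = complVertex r ∨ j ≠ r.1 ∧ G (j, b) (complVertex r) := by
    intro j
    by_cases hj : j = r.1
    · exact ⟨!r.2, Or.inl (by rw [hj]; rfl)⟩
    · rcases hG.total (u := (j, true)) (v := r) hj with h | h | h | h
      · exact absurd h (hmin _)
      · exact ⟨true, Or.inr ⟨hj, h⟩⟩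
      · exact absurd h (hmin _)
      · exact ⟨false, Or.inr ⟨hj, hG.compl h⟩⟩
  choose c hc using ha
  have htopeq : (r.1, c r.1) = complVertex r := (hc r.1).resolve_right fun h => h.1 rfl
  have hforb : ∀ j k, ¬ G (complVertex (j, c j)) (k, c k) := by
    intro j k h
    have h2 : G (complVertex (j, c j)) (complVertex r) := by
      rcases hc k with h' | h'
      · exact h' ▸ h
      · exact htrans h h'.2
    rcases hc j with h' | h'
    · rw [h', complVertex_complVertex] at h2
      exact hG.fst_ne h2 rfl
    · exact hG.not_compl_left h'.2 h2
  have hresult := compatible_of_forest (M := M) (Q := fun i => P i (c i))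
    (R := fun i => P i !(c i)) (fun i => hsum i (c i)) (fun i => hne i (c i)) r.1 (hne _ _)
    (lt := fun i j => G (i, c i) (j, c j)) (fun _ _ _ => htrans) (fun _ _ h => hG.part_lt h)
    ?_ ?_ ?_
  · refine (congrArg (Compatible M) (Multiset.map_congr rfl fun i _ => ?_)).mp hresult
    cases c i
    · exact Sym2.eq_swap
    · rfl
  · intro i j k hij hik
    by_cases hjk : j = k
    · exact Or.inl hjk
    rcases hG.total (u := (j, c j)) (v := (k, c k)) hjk with h | h | h | h
    · exact Or.inr (Or.inl h)
    · exact absurd (htrans hij h) (hG.not_compl_right hik)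
    · exact absurd h (hforb j k)
    · exact Or.inr (Or.inr h)
  · intro j hj
    rw [htopeq]
    refine ((hc j).resolve_left fun h => hj ?_).2
    exact congrArg Prod.fst h
  · intro j
    refine le_trans ?_ (hcons (j, c j))
    have hinj : Function.Injective fun i => (i, c i) := fun i k h => congrArg Prod.fst h
    rw [← Finset.sum_image (f := fun w : Fin n × Bool => P w.1 w.2) hinj.injOn]
    refine Finset.sum_le_sum_of_subset fun w hw => ?_
    obtain ⟨i, hi, rfl⟩ := Finset.mem_image.1 hw
    obtain ⟨hij, hcov⟩ := (Finset.mem_filter.1 hi).2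
    refine Finset.mem_filter.2 ⟨Finset.mem_univ _, hij, ?_⟩
    rintro ⟨w, hiw, hwj, hpath⟩
    have hw : G w (j, c j) := by
      clear hiw hwj
      induction hpath using Relation.TransGen.head_induction_on with
      | single h => exact h
      | head h _ ih => exact htrans h ih
    rcases eq_or_eq_complVertex (u := w) (v := (w.1, c w.1)) rfl with h | h
    · rw [h] at hiw hw
      rcases hcov _ hiw with h' | h'
      · exact hG.fst_ne hw h'
      · exact ((hG.part_lt hw).trans (hG.part_lt h')).false
    · rw [h] at hw
      exact hforb _ _ hw

end Thin

/-- Theorem, characterization of compatibility.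
Let `𝔖 = {S₁, …, Sₙ}` be a split system on a finite multiset `M` (split `i` having
parts `P i true` and `P i false`). Then `𝔖` is compatible if and only if the
split-containment graph `Γ(𝔖)` has a consistent thin subgraph. -/
theorem stmt0 {X : Type} [DecidableEq X] (M : Multiset X) {n : ℕ}
    (P : Fin n → Bool → Multiset X)
    (hne : ∀ i b, P i b ≠ 0) (hsum : ∀ i, P i true + P i false = M) :
    Compatible M (splitSystemOf P) ↔
      ∃ G : Fin n × Bool → Fin n × Bool → Prop,
        IsThinSubgraph P G ∧ IsConsistent P G := by
  constructor
  · exact exists_consistent_thin_of_compatible hne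
  · rintro ⟨G, hG, hcons⟩
    refine compatible_of_consistent_thin hne (fun i b => ?_) hG hcons
    cases b
    · rw [add_comm]
      exact hsum i
    · exact hsum i
end

section
/- Let 𝔖 = {S₁,…,Sₙ}, n ≥ 1, be a split system on a finite multiset 𝓜, and let G be a consistent thin subgraph of Γ(𝔖). Then for two vertices (A,Sᵢ), (B,Sⱼ) of G with i ≠ j, the pair ((A,Sᵢ),(B,Sⱼ)) is an arc of G if and only if there is a directed path in G from (A,Sᵢ) to (B,Sⱼ) consisting only of critical arcs of G. -/
open scoped Classical

namespace IsThinSubgraph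

open Relation

variable {X : Type} {n : ℕ} {P : Fin n → Bool → Multiset X}
  {G : Fin n × Bool → Fin n × Bool → Prop}

/-- The vertex `(Ā, Sᵢ)` opposite to `(A, Sᵢ)`. -/
def opp {n : ℕ} (u : Fin n × Bool) : Fin n × Bool := (u.1, !u.2)

@[simp] theorem opp_opp (u : Fin n × Bool) : opp (opp u) = u := by
  simp [opp]

theorem opp_ne (u : Fin n × Bool) : opp u ≠ u := by
  simp [opp, Prod.ext_iff]

theorem part_add_part_opp {M : Multiset X} (hsum : ∀ i, P i true + P i false = M)
    (u : Fin n × Bool) : P u.1 u.2 + P (opp u).1 (opp u).2 = M := by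
  obtain ⟨i, b⟩ := u
  cases b
  · simpa [opp, add_comm] using hsum i
  · simpa [opp] using hsum i

theorem arc_opp (h : IsThinSubgraph P G) {u v : Fin n × Bool} (huv : G u v) :
    G (opp v) (opp u) := by
  obtain ⟨b, c, hbc⟩ := h.2 u.1 v.1 (h.1 u v huv).1
  obtain ⟨hb, hc⟩ := (hbc u.2 v.2).1.1 huv
  exact (hbc (!u.2) (!v.2)).2.2 ⟨by rw [hc], by rw [hb]⟩

theorem exists_arc (h : IsThinSubgraph P G) {u v : Fin n × Bool} (huv : u.1 ≠ v.1) :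
    G u v ∨ G v (opp u) ∨ G (opp u) v ∨ G v u := by
  obtain ⟨i, b'⟩ := u
  obtain ⟨j, c'⟩ := v
  obtain ⟨b, c, hbc⟩ := h.2 i j huv
  have h1 := hbc b' c'
  have h2 := hbc (!b') c'
  simp only [opp]
  rw [h1.1, h1.2, h2.1, h2.2]
  cases b <;> cases c <;> cases b' <;> cases c' <;> simp

theorem transGen_opp (h : IsThinSubgraph P G) {u v : Fin n × Bool} (huv : TransGen G u v) :
    TransGen G (opp v) (opp u) := by
  induction huv with
  | single h' => exact .single (h.arc_opp h')
  | tail _ h' ih => exact .head (h.arc_opp h') ih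

theorem part_lt_of_transGen (h : IsThinSubgraph P G) {u v : Fin n × Bool}
    (huv : TransGen G u v) : P u.1 u.2 < P v.1 v.2 := by
  induction huv with
  | single h' => exact (h.1 _ _ h').2
  | tail _ h' ih => exact ih.trans (h.1 _ _ h').2

theorem part_le_of_reflTransGen (h : IsThinSubgraph P G) {u v : Fin n × Bool}
    (huv : ReflTransGen G u v) : P u.1 u.2 ≤ P v.1 v.2 := by
  rcases reflTransGen_iff_eq_or_transGen.1 huv with rfl | h'
  · exact le_rfl
  · exact (h.part_lt_of_transGen h').le

/-- Every arc of a thin subgraph is refined by a path of critical arcs. -/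
theorem transGen_isCriticalArc_of_arc (h : IsThinSubgraph P G) {u v : Fin n × Bool}
    (huv : G u v) : TransGen (IsCriticalArc G) u v := by
  by_cases hc : IsCriticalArc G u v
  · exact .single hc
  obtain ⟨w, huw, -, hwv⟩ : ∃ w, G u w ∧ w ≠ v ∧ TransGen G w v := by
    by_contra hw
    exact hc ⟨huv, hw⟩
  -- Each arc of the detour through `w` spans a smaller range of cardinalities.
  have huw' := Multiset.card_lt_card (h.1 _ _ huw).2
  have hwv' := Multiset.card_lt_card (h.part_lt_of_transGen hwv)
  have key : ∀ {x}, TransGen G w x →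
      (P x.1 x.2).card ≤ (P v.1 v.2).card → TransGen (IsCriticalArc G) w x := by
    intro x hx
    induction hx with
    | single hwb =>
      intro _
      exact transGen_isCriticalArc_of_arc h hwb
    | tail hwa hab ih =>
      intro _
      have h1 := Multiset.card_lt_card (h.part_lt_of_transGen hwa)
      have h2 := Multiset.card_lt_card (h.1 _ _ hab).2
      exact (ih (by omega)).trans (transGen_isCriticalArc_of_arc h hab)
  exact (transGen_isCriticalArc_of_arc h huw).trans (key hwv le_rfl)
termination_by (P v.1 v.2).card - (P u.1 u.2).card
decreasing_by all_goals omega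

theorem transGen_isCriticalArc (h : IsThinSubgraph P G) {u v : Fin n × Bool}
    (huv : TransGen G u v) : TransGen (IsCriticalArc G) u v := by
  induction huv with
  | single h' => exact h.transGen_isCriticalArc_of_arc h'
  | tail _ h' ih => exact ih.trans (h.transGen_isCriticalArc_of_arc h')

theorem exists_last_isCriticalArc (h : IsThinSubgraph P G) {u v : Fin n × Bool}
    (huv : TransGen G u v) : ∃ a, ReflTransGen G u a ∧ IsCriticalArc G a v := by
  obtain ⟨a, hua, hav⟩ := TransGen.tail'_iff.1 (h.transGen_isCriticalArc huv)
  exact ⟨a, ReflTransGen.mono (fun _ _ hc => hc.1) _ _ hua, hav⟩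

end IsThinSubgraph

theorem IsConsistent.add_le {X : Type} {n : ℕ} {P : Fin n → Bool → Multiset X}
    {G : Fin n × Bool → Fin n × Bool → Prop} (hcons : IsConsistent P G)
    {a b u : Fin n × Bool} (hab : a ≠ b) (ha : IsCriticalArc G a u)
    (hb : IsCriticalArc G b u) : P a.1 a.2 + P b.1 b.2 ≤ P u.1 u.2 := by
  rw [← Finset.sum_pair (f := fun w : Fin n × Bool => P w.1 w.2) hab]
  refine le_trans (Finset.sum_le_sum_of_subset ?_) (hcons u)
  intro w hw
  simp only [Finset.mem_insert, Finset.mem_singleton] at hw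
  rcases hw with rfl | rfl <;> simpa

namespace IsThinSubgraph

open Relation

variable {X : Type} {n : ℕ} {M : Multiset X} {P : Fin n → Bool → Multiset X}
  {G : Fin n × Bool → Fin n × Bool → Prop}

theorem card_part_lt (hne : ∀ i b, P i b ≠ 0) (hsum : ∀ i, P i true + P i false = M)
    (u : Fin n × Bool) : (P u.1 u.2).card < M.card := by
  have := congrArg Multiset.card (part_add_part_opp hsum u)
  have h0 := Multiset.card_pos.2 (hne (opp u).1 (opp u).2)
  rw [Multiset.card_add] at this
  omega

/-- In a consistent thin subgraph, no vertex is reachable from both parts of a split. -/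
theorem not_reflTransGen_of_reflTransGen_opp (h : IsThinSubgraph P G)
    (hcons : IsConsistent P G) (hne : ∀ i b, P i b ≠ 0)
    (hsum : ∀ i, P i true + P i false = M) {w x : Fin n × Bool}
    (hw : ReflTransGen G w x) (hw' : ReflTransGen G (opp w) x) : False := by
  induction hk : (P x.1 x.2).card using Nat.strong_induction_on generalizing w x with
  | _ k ih =>
  subst hk
  have both : ∀ w, TransGen G w x → TransGen G (opp w) x → False := by
    intro w hw hw'
    obtain ⟨a, hwa, ha⟩ := h.exists_last_isCriticalArc hw
    obtain ⟨b, hwb, hb⟩ := h.exists_last_isCriticalArc hw'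
    rcases eq_or_ne a b with rfl | hab
    · exact ih _ (Multiset.card_lt_card (h.1 _ _ ha.1).2) hwa hwb rfl
    · have h1 := add_le_add (h.part_le_of_reflTransGen hwa) (h.part_le_of_reflTransGen hwb)
      rw [part_add_part_opp hsum] at h1
      have h2 := Multiset.card_le_card (h1.trans (hcons.add_le hab ha hb))
      exact absurd (card_part_lt hne hsum x) (by omega)
  have self : TransGen G (opp x) x → False := by
    intro hx
    rcases TransGen.tail'_iff.1 hx with ⟨b, hxb, hbx⟩
    rcases reflTransGen_iff_eq_or_transGen.1 hxb with rfl | hxb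
    · exact (h.1 _ _ hbx).1 rfl
    · exact both b (.single hbx) (by simpa using h.transGen_opp hxb)
  rcases reflTransGen_iff_eq_or_transGen.1 hw with rfl | hw
  · rcases reflTransGen_iff_eq_or_transGen.1 hw' with hx | hw'
    · exact opp_ne _ hx.symm
    · exact self hw'
  · rcases reflTransGen_iff_eq_or_transGen.1 hw' with rfl | hw'
    · exact self (by simpa using hw)
    · exact both w hw hw'

end IsThinSubgraph

/-- Lemma: consistent thin subgraphs are determined by their
critical arcs. Let `𝔖 = {S₁, …, Sₙ}`, `n ≥ 1`, be a split system on `M` and let `G`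
be a consistent thin subgraph of `Γ(𝔖)`. Then for vertices `(A,Sᵢ)`, `(B,Sⱼ)` with
`i ≠ j`, the pair `((A,Sᵢ),(B,Sⱼ))` is an arc of `G` iff there is a directed path in
`G` from `(A,Sᵢ)` to `(B,Sⱼ)` consisting only of critical arcs of `G`. -/
theorem stmt1 {X : Type} [DecidableEq X] (M : Multiset X) {n : ℕ} (hn : 1 ≤ n)
    (P : Fin n → Bool → Multiset X)
    (hne : ∀ i b, P i b ≠ 0) (hsum : ∀ i, P i true + P i false = M)
    (G : Fin n × Bool → Fin n × Bool → Prop)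
    (hthin : IsThinSubgraph P G) (hcons : IsConsistent P G)
    (u v : Fin n × Bool) (huv : u.1 ≠ v.1) :
    G u v ↔ Relation.TransGen (IsCriticalArc G) u v := by
  refine ⟨hthin.transGen_isCriticalArc_of_arc, fun hc => ?_⟩
  have hp : Relation.TransGen G u v := Relation.TransGen.mono (fun _ _ h => h.1) _ _ hc
  rcases hthin.exists_arc huv with h | h | h | h
  · exact h
  · exact (hthin.not_reflTransGen_of_reflTransGen_opp hcons hne hsum
      (hp.tail h).to_reflTransGen .refl).elim
  · exact (hthin.not_reflTransGen_of_reflTransGen_opp hcons hne hsum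
      hp.to_reflTransGen (.single h)).elim
  · exact (lt_irrefl _ (hthin.part_lt_of_transGen (hp.tail h))).elim
end
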